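/- arXiv:1310.1907 — 3 statements merged into one kernel-verified Lean document; each statement's English description precedes it below -/
import Mathlib

section
/- Let Γ be a bilinear lattice and E = (e_1,…,e_r) an exceptional sequence. Define l_a(x) = x − (⟨a,x⟩/⟨a,a⟩)·a for a pseudo-real root a, and l_E = l_{e_1}∘⋯∘l_{e_r}. Then for every x ∈ Γ: (1) l_E(x) ∈ E^⊥; (2) l_E(x) = x for x ∈ E^⊥; (3) l_E(x) = 0 if and only if x ∈ ℤE. Consequently Γ = ℤE ⊕ E^⊥ and l_E is the projection onto E^⊥ along ℤE. -/
/-- An element `a` is a pseudo-real root if `⟨a,a⟩ > 0` and `⟨a,a⟩` divides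
`⟨a,x⟩` and `⟨x,a⟩` for all `x`. -/
def IsPseudoReal {Γ : Type} [AddCommGroup Γ] (B : Γ →ₗ[ℤ] Γ →ₗ[ℤ] ℤ) (a : Γ) : Prop :=
  0 < B a a ∧ ∀ x : Γ, B a a ∣ B a x ∧ B a a ∣ B x a

/-- Non-degeneracy of the bilinear form. -/
def Nondeg {Γ : Type} [AddCommGroup Γ] (B : Γ →ₗ[ℤ] Γ →ₗ[ℤ] ℤ) : Prop :=
  (∀ x, (∀ y, B x y = 0) → x = 0) ∧ (∀ y, (∀ x, B x y = 0) → y = 0)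

/-- The transformation `l_a(x) = x - (⟨a,x⟩/⟨a,a⟩) • a`. -/
def lRefl {Γ : Type} [AddCommGroup Γ] (B : Γ →ₗ[ℤ] Γ →ₗ[ℤ] ℤ) (a x : Γ) : Γ :=
  x - (B a x / B a a) • a

/-- `l_E = l_{e_1} ∘ ⋯ ∘ l_{e_r}` for a list `E = [e_1, …, e_r]`. -/
def lSeq {Γ : Type} [AddCommGroup Γ] (B : Γ →ₗ[ℤ] Γ →ₗ[ℤ] ℤ) (l : List Γ) (x : Γ) : Γ :=
  l.foldr (lRefl B) x

/-- The right orthogonal complement `E^⊥ = {x : ⟨e_i, x⟩ = 0 for all i}`. -/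
def rightPerp {Γ : Type} [AddCommGroup Γ] (B : Γ →ₗ[ℤ] Γ →ₗ[ℤ] ℤ)
    {r : ℕ} (e : Fin r → Γ) : Submodule ℤ Γ :=
  ⨅ i, LinearMap.ker (B (e i))

section ExceptionalList

variable {Γ : Type} [AddCommGroup Γ] (B : Γ →ₗ[ℤ] Γ →ₗ[ℤ] ℤ)

theorem lSeq_cons (a : Γ) (l : List Γ) (x : Γ) :
    lSeq B (a :: l) x = lRefl B a (lSeq B l x) := rfl

variable {B}

theorem IsPseudoReal.apply_lRefl_self {a : Γ} (ha : IsPseudoReal B a) (x : Γ) :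
    B a (lRefl B a x) = 0 := by
  simp only [lRefl, map_sub, map_smul, smul_eq_mul]
  rw [Int.ediv_mul_cancel (ha.2 x).1, sub_self]

theorem apply_lRefl_of_eq_zero {a b : Γ} (h : B b a = 0) (x : Γ) :
    B b (lRefl B a x) = B b x := by
  simp [lRefl, h]

theorem apply_lSeq_eq_zero {l : List Γ} (hroot : ∀ a ∈ l, IsPseudoReal B a)
    (hexc : l.Pairwise fun a b => B b a = 0) (x : Γ) : ∀ b ∈ l, B b (lSeq B l x) = 0 := by
  induction l with
  | nil => simp
  | cons a l ih =>
    rw [List.forall_mem_cons] at hroot ⊢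
    rw [List.pairwise_cons] at hexc
    refine ⟨hroot.1.apply_lRefl_self _, fun b hb => ?_⟩
    rw [lSeq_cons, apply_lRefl_of_eq_zero (hexc.1 b hb)]
    exact ih hroot.2 hexc.2 b hb

theorem lSeq_eq_self {l : List Γ} {x : Γ} (hx : ∀ b ∈ l, B b x = 0) : lSeq B l x = x := by
  induction l with
  | nil => rfl
  | cons a l ih =>
    rw [List.forall_mem_cons] at hx
    rw [lSeq_cons, ih hx.2]
    simp [lRefl, hx.1]

variable (B) in
theorem sub_lSeq_mem_span (l : List Γ) (x : Γ) :
    x - lSeq B l x ∈ Submodule.span ℤ {a | a ∈ l} := by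
  induction l with
  | nil => simp [lSeq]
  | cons a l ih =>
    rw [lSeq_cons, lRefl, ← sub_add]
    refine add_mem (Submodule.span_mono (fun b hb => List.mem_cons_of_mem a hb) ih) ?_
    exact Submodule.smul_mem _ _ (Submodule.subset_span List.mem_cons_self)

theorem eq_zero_of_mem_span_of_apply_eq_zero {l : List Γ} (hroot : ∀ a ∈ l, IsPseudoReal B a)
    (hexc : l.Pairwise fun a b => B b a = 0) {y : Γ}
    (hy : y ∈ Submodule.span ℤ {a | a ∈ l}) (hperp : ∀ b ∈ l, B b y = 0) : y = 0 := by
  induction l generalizing y with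
  | nil => simpa using hy
  | cons a l ih =>
    rw [List.forall_mem_cons] at hroot hperp
    rw [List.pairwise_cons] at hexc
    have hset : {b | b ∈ a :: l} = insert a {b | b ∈ l} := by ext; simp
    rw [hset, Submodule.mem_span_insert] at hy
    obtain ⟨c, z, hz, rfl⟩ := hy
    obtain rfl : z = 0 := ih hroot.2 hexc.2 hz fun b hb => by
      simpa [hexc.1 b hb] using hperp.2 b hb
    have hc : c = 0 := by simpa [hroot.1.1.ne'] using hperp.1
    simp [hc]

end ExceptionalList

theorem statement2 (Γ : Type) [AddCommGroup Γ] [Module.Free ℤ Γ] [Module.Finite ℤ Γ]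
    (B : Γ →ₗ[ℤ] Γ →ₗ[ℤ] ℤ) (hB : Nondeg B)
    (r : ℕ) (e : Fin r → Γ)
    (hroot : ∀ i, IsPseudoReal B (e i))
    (hexc : ∀ i j : Fin r, j < i → B (e i) (e j) = 0) :
    (∀ x : Γ, lSeq B (List.ofFn e) x ∈ rightPerp B e) ∧
    (∀ x ∈ rightPerp B e, lSeq B (List.ofFn e) x = x) ∧
    (∀ x : Γ, lSeq B (List.ofFn e) x = 0 ↔ x ∈ Submodule.span ℤ (Set.range e)) ∧
    IsCompl (Submodule.span ℤ (Set.range e)) (rightPerp B e) ∧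
    (∀ x : Γ, x - lSeq B (List.ofFn e) x ∈ Submodule.span ℤ (Set.range e)) := by
  have hset : {a | a ∈ List.ofFn e} = Set.range e := by ext; simp [List.mem_ofFn]
  have hroot' : ∀ a ∈ List.ofFn e, IsPseudoReal B a := by
    simpa [List.mem_ofFn] using hroot
  have hexc' : (List.ofFn e).Pairwise fun a b => B b a = 0 :=
    List.pairwise_ofFn.2 fun i j hij => hexc j i hij
  have hmem : ∀ x, x ∈ rightPerp B e ↔ ∀ b ∈ List.ofFn e, B b x = 0 := by
    simp [rightPerp, List.mem_ofFn]
  have hperp : ∀ x, lSeq B (List.ofFn e) x ∈ rightPerp B e := fun x =>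
    (hmem _).2 (apply_lSeq_eq_zero hroot' hexc' x)
  have hsub : ∀ x, x - lSeq B (List.ofFn e) x ∈ Submodule.span ℤ (Set.range e) := fun x =>
    hset ▸ sub_lSeq_mem_span B (List.ofFn e) x
  have hzero : ∀ y ∈ Submodule.span ℤ (Set.range e), y ∈ rightPerp B e → y = 0 := fun y hy hy' =>
    eq_zero_of_mem_span_of_apply_eq_zero hroot' hexc' (hset.symm ▸ hy) ((hmem y).1 hy')
  refine ⟨hperp, fun x hx => lSeq_eq_self ((hmem x).1 hx), fun x => ⟨fun h => ?_, fun h => ?_⟩,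
    ⟨Submodule.disjoint_def.2 hzero, codisjoint_iff.2 (eq_top_iff.2 fun x _ => ?_)⟩, hsub⟩
  · simpa [h] using hsub x
  · exact hzero _ ((Submodule.sub_mem_iff_right _ h).1 (hsub x)) (hperp x)
  · exact Submodule.mem_sup.2 ⟨_, hsub x, _, hperp x, sub_add_cancel _ _⟩
end

section
/- Let Γ be a bilinear lattice, E = (e_1,…,e_r) an exceptional sequence, and s_E = s_{e_1}∘⋯∘s_{e_r} the composite of the associated reflections. Then for all x ∈ Γ: ⟨y, s_E(x)⟩ = −⟨x,y⟩ whenever y ∈ ℤE, and ⟨y, s_E(x)⟩ = ⟨y,x⟩ whenever y ∈ ^⊥E. -/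
/-- The reflection `s_a(x) = x - 2((x,a)/(a,a)) • a`, where `(x,y) = ⟨x,y⟩ + ⟨y,x⟩`. -/
def sRefl {Γ : Type} [AddCommGroup Γ] (B : Γ →ₗ[ℤ] Γ →ₗ[ℤ] ℤ) (a x : Γ) : Γ :=
  x - ((2 * (B x a + B a x)) / (2 * B a a)) • a

/-- `s_E = s_{e_1} ∘ ⋯ ∘ s_{e_r}` for a list `E = [e_1, …, e_r]`. -/
def sSeq {Γ : Type} [AddCommGroup Γ] (B : Γ →ₗ[ℤ] Γ →ₗ[ℤ] ℤ) (l : List Γ) (x : Γ) : Γ :=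
  l.foldr (sRefl B) x

/-- The left orthogonal complement `^⊥E = {x : ⟨x, e_i⟩ = 0 for all i}`. -/
def leftPerp {Γ : Type} [AddCommGroup Γ] (B : Γ →ₗ[ℤ] Γ →ₗ[ℤ] ℤ)
    {r : ℕ} (e : Fin r → Γ) : Submodule ℤ Γ :=
  ⨅ i, LinearMap.ker (B.flip (e i))

/-- A linear functional killing every member of `l` is invariant under `sSeq B l`. -/
theorem apply_sSeq_of_vanish {Γ : Type} [AddCommGroup Γ] (B : Γ →ₗ[ℤ] Γ →ₗ[ℤ] ℤ)
    (f : Γ →ₗ[ℤ] ℤ) (l : List Γ) (hf : ∀ a ∈ l, f a = 0) (x : Γ) :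
    f (sSeq B l x) = f x := by
  induction l with
  | nil => rfl
  | cons a l ih =>
    change f (sRefl B a (sSeq B l x)) = f x
    rw [sRefl, map_sub, map_smul, hf a List.mem_cons_self, smul_zero, sub_zero]
    exact ih fun b hb => hf b (List.mem_cons_of_mem a hb)

theorem IsPseudoReal.apply_sRefl_self {Γ : Type} [AddCommGroup Γ] {B : Γ →ₗ[ℤ] Γ →ₗ[ℤ] ℤ}
    {a : Γ} (ha : IsPseudoReal B a) (x : Γ) : B a (sRefl B a x) = -B x a := by
  obtain ⟨h₁, h₂⟩ := ha.2 x
  rw [sRefl, Int.mul_ediv_mul_of_pos _ _ two_pos, map_sub, map_smul, smul_eq_mul,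
    Int.ediv_mul_cancel (dvd_add h₂ h₁)]
  ring

/-- On the members of an exceptional list `l`, `sSeq B l` acts as minus the transposition of the
form. -/
theorem apply_sSeq_of_mem {Γ : Type} [AddCommGroup Γ] (B : Γ →ₗ[ℤ] Γ →ₗ[ℤ] ℤ) (l : List Γ)
    (hroot : ∀ a ∈ l, IsPseudoReal B a) (hexc : l.Pairwise fun a b => B b a = 0)
    (x y : Γ) (hy : y ∈ l) : B y (sSeq B l x) = -B x y := by
  induction l with
  | nil => simp at hy
  | cons a l ih =>
    change B y (sRefl B a (sSeq B l x)) = _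
    obtain ⟨hal, hl⟩ := List.pairwise_cons.1 hexc
    rcases List.mem_cons.1 hy with rfl | hy
    · rw [(hroot y List.mem_cons_self).apply_sRefl_self]
      exact congrArg Neg.neg (apply_sSeq_of_vanish B (B.flip y) l hal x)
    · rw [sRefl, map_sub, map_smul, hal y hy, smul_zero, sub_zero]
      exact ih (fun b hb => hroot b (List.mem_cons_of_mem a hb)) hl hy

theorem statement3 (Γ : Type) [AddCommGroup Γ] [Module.Free ℤ Γ] [Module.Finite ℤ Γ]
    (B : Γ →ₗ[ℤ] Γ →ₗ[ℤ] ℤ) (hB : Nondeg B)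
    (r : ℕ) (e : Fin r → Γ)
    (hroot : ∀ i, IsPseudoReal B (e i))
    (hexc : ∀ i j : Fin r, j < i → B (e i) (e j) = 0) :
    ∀ x y : Γ,
      (y ∈ Submodule.span ℤ (Set.range e) → B y (sSeq B (List.ofFn e) x) = - B x y) ∧
      (y ∈ leftPerp B e → B y (sSeq B (List.ofFn e) x) = B y x) := by
  intro x y
  refine ⟨fun hy => ?_, fun hy => ?_⟩
  · have hspan : Submodule.span ℤ (Set.range e) ≤
        LinearMap.ker (B.flip (sSeq B (List.ofFn e) x) + B x) := by
      rw [Submodule.span_le]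
      rintro _ ⟨i, rfl⟩
      have hi := apply_sSeq_of_mem B (List.ofFn e) (List.forall_mem_ofFn_iff.2 hroot)
        (List.pairwise_ofFn.2 fun i j hij => hexc j i hij) x (e i)
        (List.mem_ofFn.2 ⟨i, rfl⟩)
      simp [hi]
    exact eq_neg_of_add_eq_zero_left (hspan hy)
  · refine apply_sSeq_of_vanish B (B y) _ (List.forall_mem_ofFn_iff.2 fun i => ?_) x
    exact (Submodule.mem_iInf _).1 hy i
end

section
/- Let Γ be a bilinear lattice and let E, F be exceptional sequences with s_E = s_F. Then ℤE + rad Γ = ℤF + rad Γ, where rad Γ = {x ∈ Γ : (x,y) = 0 for all y}. -/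
/-- The radical rad Γ = {x : (x,y) = 0 for all y}. -/
def radical {Γ : Type} [AddCommGroup Γ] (B : Γ →ₗ[ℤ] Γ →ₗ[ℤ] ℤ) : Submodule ℤ Γ :=
  LinearMap.ker (B + B.flip)

section ExceptionalList

variable {Γ : Type} [AddCommGroup Γ] {B : Γ →ₗ[ℤ] Γ →ₗ[ℤ] ℤ}

/-- For a pseudo-real root `a`, the reflection `s_a` subtracts the integer multiple
`((x,a)/⟨a,a⟩) • a`. -/
theorem IsPseudoReal.exists_sRefl_eq {a : Γ} (ha : IsPseudoReal B a) (x : Γ) :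
    ∃ c : ℤ, sRefl B a x = x - c • a ∧ c * B a a = B x a + B a x := by
  obtain ⟨c, hc⟩ : B a a ∣ B x a + B a x := dvd_add (ha.2 x).2 (ha.2 x).1
  have hpos := ha.1
  refine ⟨c, ?_, by rw [hc, mul_comm]⟩
  rw [sRefl, hc, ← mul_assoc, Int.mul_ediv_cancel_left _ (by positivity)]

theorem sub_sSeq_mem_span (B : Γ →ₗ[ℤ] Γ →ₗ[ℤ] ℤ) (l : List Γ) (x : Γ) :
    x - sSeq B l x ∈ Submodule.span ℤ {u | u ∈ l} := by
  induction l with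
  | nil => simp [sSeq]
  | cons a t ih =>
    have hsub : Submodule.span ℤ {u | u ∈ t} ≤ Submodule.span ℤ {u | u ∈ a :: t} :=
      Submodule.span_mono fun u hu => List.mem_cons_of_mem a hu
    have ha : a ∈ Submodule.span ℤ {u | u ∈ a :: t} :=
      Submodule.subset_span List.mem_cons_self
    change x - sRefl B a (sSeq B t x) ∈ _
    rw [sRefl, ← sub_add]
    exact add_mem (hsub ih) (Submodule.smul_mem _ _ ha)

/-- The vector `x - s_E(x)` represents the functional `(x,-)` on the span of an exceptional
sequence `E`. -/
theorem apply_sub_sSeq {l : List Γ} (hroot : ∀ a ∈ l, IsPseudoReal B a)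
    (hexc : l.Pairwise fun a b => B b a = 0) (x : Γ) {u : Γ}
    (hu : u ∈ Submodule.span ℤ {u | u ∈ l}) :
    B u (x - sSeq B l x) = B x u + B u x := by
  suffices h : ∀ u ∈ l, B u (x - sSeq B l x) = B x u + B u x from
    LinearMap.eqOn_span (f := B.flip (x - sSeq B l x)) (g := B x + B.flip x) h hu
  clear hu u
  induction l with
  | nil => simp
  | cons a t ih =>
    rw [List.pairwise_cons] at hexc
    have ih := ih (fun b hb => hroot b (List.mem_cons_of_mem a hb)) hexc.2
    have hat : B (x - sSeq B t x) a = 0 := by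
      have h := LinearMap.eqOn_span (f := B.flip a) (g := 0) hexc.1
        (sub_sSeq_mem_span B t x)
      simpa using h
    obtain ⟨c, hc, hca⟩ := (hroot a List.mem_cons_self).exists_sRefl_eq (sSeq B t x)
    intro u hu
    change B u (x - sRefl B a (sSeq B t x)) = _
    rw [hc]
    simp only [map_sub, map_smul, smul_eq_mul, LinearMap.sub_apply] at ih hat ⊢
    rcases List.mem_cons.1 hu with rfl | hu
    · linarith
    · rw [hexc.1 u hu]
      linarith [ih u hu]

/-- The span of an exceptional sequence admits integral projections. -/
theorem exists_projection {l : List Γ} (hroot : ∀ a ∈ l, IsPseudoReal B a)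
    (hexc : l.Pairwise fun a b => B b a = 0) (u : Γ) :
    ∃ v ∈ Submodule.span ℤ {w | w ∈ l},
      ∀ w ∈ Submodule.span ℤ {w | w ∈ l}, B v w = B u w := by
  suffices h : ∃ v ∈ Submodule.span ℤ {w | w ∈ l}, ∀ w ∈ l, B v w = B u w by
    obtain ⟨v, hv, h⟩ := h
    exact ⟨v, hv, fun w hw => LinearMap.eqOn_span h hw⟩
  induction l generalizing u with
  | nil => exact ⟨0, zero_mem _, by simp⟩
  | cons a t ih =>
    rw [List.pairwise_cons] at hexc
    obtain ⟨c, hc⟩ := ((hroot a List.mem_cons_self).2 u).2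
    obtain ⟨v, hv, hvw⟩ :=
      ih (fun b hb => hroot b (List.mem_cons_of_mem a hb)) hexc.2 (u - c • a)
    have hva : B v a = 0 := LinearMap.eqOn_span (f := B.flip a) (g := 0) hexc.1 hv
    refine ⟨v + c • a, add_mem
      (Submodule.span_mono (fun w hw => List.mem_cons_of_mem a hw) hv)
      (Submodule.smul_mem _ _ (Submodule.subset_span List.mem_cons_self)), fun w hw => ?_⟩
    simp only [map_add, map_sub, map_smul, smul_eq_mul, LinearMap.add_apply,
      LinearMap.sub_apply, LinearMap.smul_apply] at hvw ⊢
    rcases List.mem_cons.1 hw with rfl | hw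
    · rw [hva, hc]
      ring
    · linarith [hvw w hw]

theorem span_le_span_sup_radical {l m : List Γ} (hrootl : ∀ a ∈ l, IsPseudoReal B a)
    (hexcl : l.Pairwise fun a b => B b a = 0) (hrootm : ∀ a ∈ m, IsPseudoReal B a)
    (hexcm : m.Pairwise fun a b => B b a = 0) (heq : ∀ x, sSeq B l x = sSeq B m x) :
    Submodule.span ℤ {u | u ∈ l} ≤ Submodule.span ℤ {u | u ∈ m} ⊔ radical B := by
  intro u hu
  obtain ⟨v, hv, hvu⟩ := exists_projection hrootm hexcm u
  refine Submodule.mem_sup.2 ⟨v, hv, u - v, ?_, add_sub_cancel v u⟩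
  rw [radical, LinearMap.mem_ker]
  ext x
  have h₁ := hvu _ (sub_sSeq_mem_span B m x)
  rw [apply_sub_sSeq hrootm hexcm x hv, ← heq, apply_sub_sSeq hrootl hexcl x hu] at h₁
  simp only [map_sub, LinearMap.add_apply, LinearMap.sub_apply, LinearMap.flip_apply,
    LinearMap.zero_apply]
  linarith

end ExceptionalList

theorem statement6 (Γ : Type) [AddCommGroup Γ] [Module.Free ℤ Γ] [Module.Finite ℤ Γ]
    (B : Γ →ₗ[ℤ] Γ →ₗ[ℤ] ℤ) (hB : Nondeg B)
    (r s : ℕ) (e : Fin r → Γ) (f : Fin s → Γ)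
    (hroote : ∀ i, IsPseudoReal B (e i))
    (hexce : ∀ i j : Fin r, j < i → B (e i) (e j) = 0)
    (hrootf : ∀ i, IsPseudoReal B (f i))
    (hexcf : ∀ i j : Fin s, j < i → B (f i) (f j) = 0)
    (heq : ∀ x : Γ, sSeq B (List.ofFn e) x = sSeq B (List.ofFn f) x) :
    Submodule.span ℤ (Set.range e) ⊔ radical B =
      Submodule.span ℤ (Set.range f) ⊔ radical B := by
  have hrange : ∀ {n : ℕ} (g : Fin n → Γ), Set.range g = {u | u ∈ List.ofFn g} := fun g => by
    ext u
    simp [List.mem_ofFn]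
  have hrl : ∀ i ∈ List.ofFn e, IsPseudoReal B i := (List.forall_mem_ofFn_iff).2 hroote
  have hrm : ∀ i ∈ List.ofFn f, IsPseudoReal B i := (List.forall_mem_ofFn_iff).2 hrootf
  have hel : (List.ofFn e).Pairwise fun a b => B b a = 0 :=
    List.pairwise_ofFn.2 fun i j hij => hexce j i hij
  have hem : (List.ofFn f).Pairwise fun a b => B b a = 0 :=
    List.pairwise_ofFn.2 fun i j hij => hexcf j i hij
  rw [hrange e, hrange f]
  exact le_antisymm
    (sup_le (span_le_span_sup_radical hrl hel hrm hem heq) le_sup_right)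
    (sup_le (span_le_span_sup_radical hrm hem hrl hel fun x => (heq x).symm) le_sup_right)
end
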